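/- arXiv:2312.07710 — 7 statements merged into one kernel-verified Lean document; each statement's English description precedes it below -/
import Mathlib

section
/- Define a list L of length 2n with entries in (ℤ/nℤ) × {+, −} as follows: for 0 ≤ j ≤ n−1, the entry of L at index 2j is ((j(n−k−1)+1) mod n, +) and the entry at index 2j+1 is ((j(n−k−1)) mod n, −). Then: (a) every element of (ℤ/nℤ) × {+, −} occurs exactly once in L; and (b) for every i ∈ ℤ/nℤ, if p is the index at which (i, −) occurs in L, then the 2(c−1) entries of L following position p in forward cyclic order are, in order, (i+(n−k−1)+1, +), (i+(n−k−1), −), (i+2(n−k−1)+1, +), (i+2(n−k−1), −), …, (i+(c−1)(n−k−1)+1, +), (i+(c−1)(n−k−1), −) (all first coordinates taken mod n), and the entry occurring 2(c−1)+1 positions after p in cyclic order is (i, +). -/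
/- STATEMENT 4 (Proposition 3.3, combinatorial form): in the list `L` of length `2n`
with entries in `(ℤ/nℤ) × {+, −}` (here `true` codes `+` and `false` codes `−`),
whose entry at index `2j` is `((j(n−k−1)+1) mod n, +)` and at index `2j+1` is
`((j(n−k−1)) mod n, −)`:
(a) every element of `(ℤ/nℤ) × {+, −}` occurs exactly once; and
(b) for every `i`, the `2(c−1)` entries cyclically following the occurrence of `(i, −)`
are `(i+j(n−k−1)+1, +), (i+j(n−k−1), −)` for `j = 1, …, c−1` in order, and the next
entry after those is `(i, +)`. -/

namespace Stmt

/-- The list `L`. -/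
def L (n k : ℕ) : List (ZMod n × Bool) :=
  (List.range (2 * n)).map fun m =>
    if m % 2 = 0 then (((m / 2 * (n - k - 1) + 1 : ℕ) : ZMod n), true)
    else (((m / 2 * (n - k - 1) : ℕ) : ZMod n), false)

theorem L_even (n k t : ℕ) (hn : 0 < n) :
    (L n k)[(2 * t) % (2 * n)]? = some ((t : ZMod n) * ((n - k - 1 : ℕ) : ZMod n) + 1, true) := by
  have h1 : (2 * t) % (2 * n) = 2 * (t % n) := Nat.mul_mod_mul_left 2 t n
  have h2 : t % n < n := Nat.mod_lt _ hn
  rw [h1]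
  unfold L
  rw [List.getElem?_map, List.getElem?_range (by omega)]
  simp

theorem L_odd (n k t : ℕ) (hn : 0 < n) :
    (L n k)[(2 * t + 1) % (2 * n)]? = some ((t : ZMod n) * ((n - k - 1 : ℕ) : ZMod n), false) := by
  have h2 : t % n < n := Nat.mod_lt _ hn
  have h1 : (2 * t + 1) % (2 * n) = 2 * (t % n) + 1 := by
    have h3 : 2 * t + 1 = (2 * (t % n) + 1) + 2 * n * (t / n) := by
      have := Nat.mod_add_div t n
      nlinarith
    rw [h3, Nat.add_mul_mod_self_left]
    apply Nat.mod_eq_of_lt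
    omega
  rw [h1]
  unfold L
  rw [List.getElem?_map, List.getElem?_range (by omega)]
  have h4 : (2 * (t % n) + 1) / 2 = t % n := by omega
  have h5 : (2 * (t % n) + 1) % 2 = 1 := by omega
  simp [h4, h5]

theorem cast_inj_of (n d c : ℕ) (hcd : (c : ZMod n) * (d : ZMod n) = -1) (a b : ℕ)
    (ha : a < n) (hb : b < n) (h : (a : ZMod n) * (d : ZMod n) = (b : ZMod n) * (d : ZMod n)) :
    a = b := by
  have h1 : (a : ZMod n) = b := by linear_combination (-(c : ZMod n)) * h + ((a : ZMod n) - b) * hcd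
  rw [ZMod.natCast_eq_natCast_iff] at h1
  exact Nat.ModEq.eq_of_lt_of_lt h1 ha hb

theorem stmt4 (n k c : ℕ) (hn : Odd n) (hn3 : 3 ≤ n)
    (hk1 : 1 ≤ k) (hk2 : k ≤ n - 2) (hgcd : Nat.gcd n (k * (k + 1)) = 1)
    (hc1 : 1 ≤ c) (hc2 : c ≤ n - 1) (hc : (c * (k + 1)) % n = 1) :
    (∀ z : ZMod n × Bool, (L n k).count z = 1) ∧
    (∀ i : ZMod n, ∀ p : ℕ, p < 2 * n → (L n k)[p]? = some (i, false) →
      (∀ j : ℕ, 1 ≤ j → j ≤ c - 1 →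
        (L n k)[(p + 2 * (j - 1) + 1) % (2 * n)]?
            = some (i + ((j * (n - k - 1) + 1 : ℕ) : ZMod n), true) ∧
        (L n k)[(p + 2 * (j - 1) + 2) % (2 * n)]?
            = some (i + ((j * (n - k - 1) : ℕ) : ZMod n), false)) ∧
      (L n k)[(p + 2 * (c - 1) + 1) % (2 * n)]? = some (i, true)) := by
  have hn0 : 0 < n := by omega
  haveI : NeZero n := ⟨by omega⟩
  have hd : ((n - k - 1 : ℕ) : ZMod n) = -((k : ZMod n) + 1) := by
    have h1 : ((n - k - 1 + (k + 1) : ℕ) : ZMod n) = (n : ℕ) := by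
      congr 1
      omega
    rw [ZMod.natCast_self] at h1
    push_cast at h1
    linear_combination h1
  have hck : (c : ZMod n) * ((k : ZMod n) + 1) = 1 := by
    have h1 : ((c * (k + 1) % n : ℕ) : ZMod n) = (1 : ℕ) := by rw [hc]
    rw [ZMod.natCast_mod] at h1
    push_cast at h1
    exact h1
  have hcd : (c : ZMod n) * ((n - k - 1 : ℕ) : ZMod n) = -1 := by
    rw [hd]
    linear_combination -hck
  constructor
  · intro z
    apply List.count_eq_one_of_mem
    · unfold L
      apply List.Nodup.map_on _ List.nodup_range
      intro x hx y hy hxy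
      rw [List.mem_range] at hx hy
      have key := cast_inj_of n (n - k - 1) c hcd (x / 2) (y / 2) (by omega) (by omega)
      split_ifs at hxy with h1 h2 h2
      · have h3 := (Prod.ext_iff.1 hxy).1
        simp only [Nat.cast_add, Nat.cast_mul, Nat.cast_one, add_left_inj] at h3
        have := key h3
        omega
      · simp at hxy
      · simp at hxy
      · have h3 := (Prod.ext_iff.1 hxy).1
        simp only [Nat.cast_mul] at h3
        have := key h3
        omega
    · obtain ⟨x, b⟩ := z
      cases b
      · have h := L_odd n k (-(x * c)).val hn0
        rw [ZMod.natCast_zmod_val] at h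
        have h2 : -(x * c) * ((n - k - 1 : ℕ) : ZMod n) = x := by linear_combination (-x) * hcd
        rw [h2] at h
        exact List.mem_of_getElem? h
      · have h := L_even n k ((1 - x) * c).val hn0
        rw [ZMod.natCast_zmod_val] at h
        have h2 : ((1 - x) * c) * ((n - k - 1 : ℕ) : ZMod n) + 1 = x := by
          linear_combination (1 - x) * hcd
        rw [h2] at h
        exact List.mem_of_getElem? h
  · intro i p hp hpi
    rcases Nat.even_or_odd' p with ⟨a, rfl | rfl⟩
    · have h := L_even n k a hn0
      rw [Nat.mod_eq_of_lt hp, hpi] at h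
      simp at h
    have h := L_odd n k a hn0
    rw [Nat.mod_eq_of_lt hp, hpi] at h
    have hi : i = (a : ZMod n) * ((n - k - 1 : ℕ) : ZMod n) := by
      simpa using h
    refine ⟨fun j hj1 hj2 => ⟨?_, ?_⟩, ?_⟩
    · rw [show 2 * a + 1 + 2 * (j - 1) + 1 = 2 * (a + j) by omega, L_even n k _ hn0, hi]
      congr 2
      push_cast
      ring
    · rw [show 2 * a + 1 + 2 * (j - 1) + 2 = 2 * (a + j) + 1 by omega, L_odd n k _ hn0, hi]
      congr 2
      push_cast
      ring
    · rw [show 2 * a + 1 + 2 * (c - 1) + 1 = 2 * (a + c) by omega, L_even n k _ hn0, hi]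
      congr 2
      push_cast
      linear_combination hcd

end Stmt
end

section
/- Let ε : M → M be the ℤ-linear map determined on the basis by ε(e_i) = e_{i+1} − e_1 for 1 ≤ i ≤ n−1 (with e_n = e_0 = 0, so ε(e_{n−1}) = −e_1). Then for every integer r with 1 ≤ r ≤ (n−1)/2, the induced map ⋀²ε on the exterior square satisfies (⋀²ε)(T_r) = T_r; that is, each T_r is invariant under ε. -/
open scoped Classical

noncomputable section

namespace Stmt

open ExteriorAlgebra

/-- `T n e r = Σ_{i=0}^{n-1} e_i ∧ e_{i+r}` in the exterior algebra of `M`. -/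
def T (n : ℕ) {M : Type*} [AddCommGroup M] [Module ℤ M] (e : ZMod n → M)
    (r : ZMod n) : ExteriorAlgebra ℤ M :=
  ∑ i ∈ Finset.range n, ι ℤ (e i) * ι ℤ (e ((i : ZMod n) + r))

/-- The coefficient `c_{I,J} = a⁺_{I,J} − a⁻_{I,J}`. -/
def cIJ (n k c : ℕ) (I J : ℕ) : ℤ :=
  (if ∃ j ∈ Finset.Icc 1 (c - 1),
      ((J : ZMod n) - (I : ZMod n)) = (j : ZMod n) * ((k : ZMod n) + 1) then 1 else 0)
  - (if ∃ j ∈ Finset.Icc 1 (c - 1),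
      ((J : ZMod n) - (I : ZMod n)) = (j : ZMod n) * ((k : ZMod n) + 1) - 1 then 1 else 0)

/-- The classifying element `Δ_{n,k} = Σ_{1 ≤ I < J ≤ n−1} c_{I,J} · e_I ∧ e_J`. -/
def Δ (n k c : ℕ) {M : Type*} [AddCommGroup M] [Module ℤ M] (e : ZMod n → M) :
    ExteriorAlgebra ℤ M :=
  ∑ I ∈ Finset.Icc 1 (n - 1), ∑ J ∈ Finset.Ioc I (n - 1),
    cIJ n k c I J • (ι ℤ (e (I : ZMod n)) * ι ℤ (e (J : ZMod n)))

theorem sum_range_cast (n : ℕ) [NeZero n] {A : Type*} [AddCommMonoid A] (f : ZMod n → A) :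
    ∑ i ∈ Finset.range n, f (i : ZMod n) = ∑ x : ZMod n, f x := by
  refine Finset.sum_bij (fun i _ => (i : ZMod n)) (fun _ _ => Finset.mem_univ _) ?_ ?_
    (fun _ _ => rfl)
  · intro a ha b hb h
    rw [Finset.mem_range] at ha hb
    have h2 := congrArg ZMod.val h
    rwa [ZMod.val_natCast_of_lt ha, ZMod.val_natCast_of_lt hb] at h2
  · intro b _
    exact ⟨b.val, Finset.mem_range.2 (ZMod.val_lt b), ZMod.natCast_zmod_val b⟩

/-- each `T_r` (for `1 ≤ r ≤ (n−1)/2`) is invariant under the map `ε`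
determined on the basis by `ε(e_i) = e_{i+1} − e_1` (with `e_n = e_0 = 0`). -/
theorem stmt8 (n : ℕ) (hn : Odd n) (hn3 : 3 ≤ n)
    (M : Type*) [AddCommGroup M] [Module ℤ M]
    (e : ZMod n → M) (he0 : e 0 = 0)
    (heInd : LinearIndependent ℤ (fun i : {x : ZMod n // x ≠ 0} => e i.val))
    (ε : M →ₗ[ℤ] M) (hε : ∀ i : ZMod n, ε (e i) = e (i + 1) - e 1) :
    ∀ r : ℕ, 1 ≤ r → r ≤ (n - 1) / 2 →
      ExteriorAlgebra.map ε (T n e (r : ZMod n)) = T n e (r : ZMod n) := by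
  intro r _ _
  haveI : NeZero n := ⟨by omega⟩
  have hT : T n e (r : ZMod n) = ∑ x : ZMod n, ι ℤ (e x) * ι ℤ (e (x + r)) :=
    sum_range_cast n (fun x => ι ℤ (e x) * ι ℤ (e (x + r)))
  have hshift : ∀ (A : Type _) [AddCommMonoid A] (f : ZMod n → A) (a : ZMod n),
      ∑ x, f (x + a) = ∑ x, f x := fun A _ f a =>
    Equiv.sum_comp (Equiv.addRight a) f
  have key : ∀ x : ZMod n, ExteriorAlgebra.map ε (ι ℤ (e x) * ι ℤ (e (x + r))) =
      ι ℤ (e (x + 1)) * ι ℤ (e (x + 1 + r)) - ι ℤ (e (x + 1)) * ι ℤ (e 1)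
        - ι ℤ (e 1) * ι ℤ (e (x + (r + 1))) := by
    intro x
    rw [map_mul, ExteriorAlgebra.map_apply_ι, ExteriorAlgebra.map_apply_ι, hε, hε, map_sub,
      map_sub, sub_mul, mul_sub, mul_sub, ExteriorAlgebra.ι_sq_zero,
      add_right_comm x 1, add_assoc x]
    abel
  rw [hT, map_sum, Finset.sum_congr rfl (fun x _ => key x), Finset.sum_sub_distrib,
    Finset.sum_sub_distrib, hshift _ (fun x => ι ℤ (e x) * ι ℤ (e (x + r))) 1,
    hshift _ (fun x => ι ℤ (e x) * ι ℤ (e 1)) 1,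
    hshift _ (fun x => ι ℤ (e 1) * ι ℤ (e x)) (r + 1), sub_sub, ← Finset.sum_add_distrib,
    Finset.sum_eq_zero (fun x _ => ExteriorAlgebra.ι_add_mul_swap (e x) (e 1)), sub_zero]

end Stmt
end
end

section
/- Suppose k = 1. Then Δ_{n,1} = Σ_{r=1}^{(n−1)/2} (−1)^r T_r in ⋀² M. -/
/- STATEMENT 9: If k = 1, then Δ_{n,1} = Σ_{r=1}^{(n−1)/2} (−1)^r T_r in ⋀² M. -/

open scoped Classical

noncomputable section

namespace Stmt

open ExteriorAlgebra

/-- The coefficient for `k = 1` is `(-1)^(J-I)`. -/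
theorem cIJ_one (m I J : ℕ) (hI : 1 ≤ I) (hIJ : I < J) (hJ : J ≤ 2 * m) :
    cIJ (2 * m + 1) 1 (m + 1) I J = (-1) ^ (J - I) := by
  have key : ∀ a : ℕ, a < 2 * m + 1 →
      (((J : ZMod (2 * m + 1)) - (I : ZMod (2 * m + 1)) = (a : ZMod (2 * m + 1))) ↔ J - I = a) := by
    intro a ha
    rw [← Nat.cast_sub hIJ.le, ZMod.natCast_eq_natCast_iff']
    rw [Nat.mod_eq_of_lt ha, Nat.mod_eq_of_lt (by omega)]
  have h1 : (∃ j ∈ Finset.Icc 1 (m + 1 - 1),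
      ((J : ZMod (2 * m + 1)) - (I : ZMod (2 * m + 1)))
        = (j : ZMod (2 * m + 1)) * (((1 : ℕ) : ZMod (2 * m + 1)) + 1)) ↔ Even (J - I) := by
    constructor
    · rintro ⟨j, hj, h⟩
      rw [Finset.mem_Icc] at hj
      have := (key (j * 2) (by omega)).1 (by rw [h]; push_cast; ring)
      exact ⟨j, by omega⟩
    · rintro ⟨j, hj⟩
      refine ⟨j, by rw [Finset.mem_Icc]; omega, ?_⟩
      rw [(key (j * 2) (by omega)).2 (by omega)]; push_cast; ring
  have h2 : (∃ j ∈ Finset.Icc 1 (m + 1 - 1),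
      ((J : ZMod (2 * m + 1)) - (I : ZMod (2 * m + 1)))
        = (j : ZMod (2 * m + 1)) * (((1 : ℕ) : ZMod (2 * m + 1)) + 1) - 1) ↔ Odd (J - I) := by
    constructor
    · rintro ⟨j, hj, h⟩
      rw [Finset.mem_Icc] at hj
      obtain ⟨t, rfl⟩ : ∃ t, j = t + 1 := ⟨j - 1, by omega⟩
      have := (key (2 * t + 1) (by omega)).1 (by rw [h]; push_cast; ring)
      exact ⟨t, by omega⟩
    · rintro ⟨j, hj⟩
      refine ⟨j + 1, by rw [Finset.mem_Icc]; omega, ?_⟩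
      rw [(key (2 * j + 1) (by omega)).2 (by omega)]; push_cast; ring
  unfold cIJ
  simp only [h1, h2]
  rcases Nat.even_or_odd (J - I) with h | h
  · simp [h, h.neg_one_pow]
  · simp [h, h.neg_one_pow]

/-- Contribution of the difference `d`. -/
def gpart (n : ℕ) {A : Type*} [AddCommGroup A] (w : ℕ → ℕ → A) (d : ℕ) : A :=
  ((-1 : ℤ) ^ d) • ∑ i ∈ Finset.range (n - d), w i (i + d)

theorem delta_side (N : ℕ) {A : Type*} [AddCommGroup A] (w : ℕ → ℕ → A)
    (h0 : ∀ j, w 0 j = 0) :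
    ∑ I ∈ Finset.Icc 1 N, ∑ J ∈ Finset.Ioc I N, ((-1 : ℤ) ^ (J - I)) • w I J
      = ∑ d ∈ Finset.Icc 1 N, gpart (N + 1) w d := by
  have e1 : ∑ I ∈ Finset.Icc 1 N, ∑ J ∈ Finset.Ioc I N, ((-1 : ℤ) ^ (J - I)) • w I J
      = ∑ I ∈ Finset.range (N + 1), ∑ J ∈ Finset.Ioc I N, ((-1 : ℤ) ^ (J - I)) • w I J := by
    apply Finset.sum_subset
    · intro x; simp only [Finset.mem_Icc, Finset.mem_range]; omega
    · intro x hx hx'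
      have : x = 0 := by
        simp only [Finset.mem_Icc, Finset.mem_range] at hx hx'; omega
      subst this
      simp [h0]
  rw [e1]
  unfold gpart
  simp only [Finset.smul_sum]
  rw [Finset.sum_sigma', Finset.sum_sigma']
  refine Finset.sum_bij' (fun p _ => ⟨p.2 - p.1, p.1⟩) (fun p _ => ⟨p.2, p.2 + p.1⟩) ?_ ?_ ?_ ?_ ?_
  · rintro ⟨a, b⟩ h
    simp only [Finset.mem_sigma, Finset.mem_range, Finset.mem_Ioc, Finset.mem_Icc] at h ⊢
    omega
  · rintro ⟨a, b⟩ h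
    simp only [Finset.mem_sigma, Finset.mem_range, Finset.mem_Ioc, Finset.mem_Icc] at h ⊢
    omega
  · rintro ⟨a, b⟩ h
    simp only [Finset.mem_sigma, Finset.mem_range, Finset.mem_Ioc] at h
    have : a + (b - a) = b := by omega
    simp [this]
  · rintro ⟨a, b⟩ h
    simp
  · rintro ⟨a, b⟩ h
    simp only [Finset.mem_sigma, Finset.mem_range, Finset.mem_Ioc] at h
    have : a + (b - a) = b := by omega
    simp [this]

theorem fold_sum (m : ℕ) {A : Type*} [AddCommGroup A] (g : ℕ → A) :
    ∑ r ∈ Finset.Icc 1 m, (g r + g (2 * m + 1 - r)) = ∑ d ∈ Finset.Icc 1 (2 * m), g d := by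
  have hu : Finset.Icc 1 (2 * m) = Finset.Icc 1 m ∪ Finset.Icc (m + 1) (2 * m) := by
    ext x; simp only [Finset.mem_union, Finset.mem_Icc]; omega
  rw [hu, Finset.sum_union, Finset.sum_add_distrib]
  · congr 1
    refine Finset.sum_bij' (fun r _ => 2 * m + 1 - r) (fun r _ => 2 * m + 1 - r) ?_ ?_ ?_ ?_ ?_
    all_goals intro a ha
    all_goals simp only [Finset.mem_Icc] at ha ⊢
    all_goals omega
  · rw [Finset.disjoint_left]
    intro x; simp only [Finset.mem_Icc]; omega

theorem T_eq (m r : ℕ) (hr1 : 1 ≤ r) (hr : r ≤ m) {M : Type*} [AddCommGroup M] [Module ℤ M]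
    (e : ZMod (2 * m + 1) → M) :
    ((-1 : ℤ) ^ r) • T (2 * m + 1) e (r : ZMod (2 * m + 1)) =
      gpart (2 * m + 1) (fun i j => ι ℤ (e (i : ZMod (2 * m + 1))) * ι ℤ (e (j : ZMod (2 * m + 1)))) r
      + gpart (2 * m + 1)
        (fun i j => ι ℤ (e (i : ZMod (2 * m + 1))) * ι ℤ (e (j : ZMod (2 * m + 1))))
        (2 * m + 1 - r) := by
  have hs : ((-1 : ℤ) ^ (2 * m + 1 - r)) = - (-1) ^ r := by
    rcases Nat.even_or_odd r with h | h
    · have h' : Odd (2 * m + 1 - r) := by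
        obtain ⟨t, ht⟩ := h
        exact ⟨m - t, by omega⟩
      rw [h.neg_one_pow, h'.neg_one_pow]
    · have h' : Even (2 * m + 1 - r) := by
        obtain ⟨t, ht⟩ := h
        exact ⟨m - t, by omega⟩
      rw [h.neg_one_pow, h'.neg_one_pow]; norm_num
  have hsplit : T (2 * m + 1) e (r : ZMod (2 * m + 1)) =
      ∑ i ∈ Finset.range ((2 * m + 1 - r) + r),
        ι ℤ (e (i : ZMod (2 * m + 1))) * ι ℤ (e ((i : ZMod (2 * m + 1)) + r)) := by
    rw [show (2 * m + 1 - r) + r = 2 * m + 1 by omega]; rfl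
  rw [hsplit, Finset.sum_range_add]
  unfold gpart
  rw [hs, show 2 * m + 1 - (2 * m + 1 - r) = r by omega, smul_add, neg_smul, ← smul_neg]
  congr 2
  · apply Finset.sum_congr rfl
    intro i _
    push_cast; rfl
  · rw [← Finset.sum_neg_distrib]
    apply Finset.sum_congr rfl
    intro t _
    have h1 : (((2 * m + 1 - r + t : ℕ) : ZMod (2 * m + 1)) + (r : ZMod (2 * m + 1)))
        = (t : ZMod (2 * m + 1)) := by
      rw [← Nat.cast_add, show 2 * m + 1 - r + t + r = (2 * m + 1) + t by omega, Nat.cast_add,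
        ZMod.natCast_self, zero_add]
    rw [h1, add_comm t]
    exact eq_neg_of_add_eq_zero_left (ExteriorAlgebra.ι_add_mul_swap _ _)

theorem stmt9 (n k c : ℕ) (hn : Odd n) (hn3 : 3 ≤ n)
    (hk1 : 1 ≤ k) (hk2 : k ≤ n - 2) (hgcd : Nat.gcd n (k * (k + 1)) = 1)
    (hc1 : 1 ≤ c) (hc2 : c ≤ n - 1) (hc : (c * (k + 1)) % n = 1)
    (M : Type*) [AddCommGroup M] [Module ℤ M]
    (e : ZMod n → M) (he0 : e 0 = 0)
    (heInd : LinearIndependent ℤ (fun i : {x : ZMod n // x ≠ 0} => e i.val))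
    (hk : k = 1) :
    Δ n k c e = ∑ r ∈ Finset.Icc 1 ((n - 1) / 2), ((-1 : ℤ) ^ r) • T n e (r : ZMod n) := by
  subst hk
  obtain ⟨m, rfl⟩ := hn
  have hcm : c = m + 1 := by
    have h1 := Nat.div_add_mod (c * (1 + 1)) (2 * m + 1)
    rw [hc] at h1
    have hlt : c * (1 + 1) / (2 * m + 1) < 2 := by
      rw [Nat.div_lt_iff_lt_mul (by omega)]; omega
    interval_cases hq : c * (1 + 1) / (2 * m + 1) <;> omega
  subst hcm
  rw [show (2 * m + 1 - 1) / 2 = m by omega]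
  rw [Finset.sum_congr rfl (fun r hr => T_eq m r (Finset.mem_Icc.1 hr).1 (Finset.mem_Icc.1 hr).2 e)]
  rw [fold_sum, ← delta_side (2 * m) _ (by intro j; simp [he0])]
  unfold Δ
  rw [show 2 * m + 1 - 1 = 2 * m by omega]
  apply Finset.sum_congr rfl
  intro I hI
  apply Finset.sum_congr rfl
  intro J hJ
  rw [Finset.mem_Icc] at hI
  rw [Finset.mem_Ioc] at hJ
  rw [cIJ_one m I J hI.1 hJ.1 hJ.2]

end Stmt
end
end

section
/- Suppose k = n−2. Then Δ_{n,n−2} = −T_1 in ⋀² M. -/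
open scoped Classical

noncomputable section

namespace Stmt

open ExteriorAlgebra

theorem cIJ_eval (m I d : ℕ) (hd1 : 1 ≤ d) (hd2 : d ≤ m) :
    cIJ (m + 2) m (m + 1) I (I + d) = if d = 1 then -1 else 0 := by
  have key : ((m : ZMod (m + 2)) + 1) = -1 := by
    have h : ((m + 2 : ℕ) : ZMod (m + 2)) = 0 := ZMod.natCast_self _
    push_cast at h
    linear_combination h
  have dv : ∀ x : ℕ, (x : ZMod (m + 2)) = 0 ↔ (m + 2) ∣ x := fun x =>
    ZMod.natCast_eq_zero_iff x (m + 2)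
  have h2 : ∃ j ∈ Finset.Icc 1 (m + 1 - 1),
      (((I + d : ℕ) : ZMod (m + 2)) - (I : ZMod (m + 2)))
        = (j : ZMod (m + 2)) * ((m : ZMod (m + 2)) + 1) - 1 := by
    refine ⟨m + 1 - d, Finset.mem_Icc.2 ⟨by omega, by omega⟩, ?_⟩
    have h : ((d + (m + 1 - d) + 1 : ℕ) : ZMod (m + 2)) = 0 := by
      rw [dv]; exact ⟨1, by omega⟩
    rw [key]
    simp only [Nat.cast_add, Nat.cast_one] at h ⊢
    linear_combination h
  have h1 : (∃ j ∈ Finset.Icc 1 (m + 1 - 1),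
      (((I + d : ℕ) : ZMod (m + 2)) - (I : ZMod (m + 2)))
        = (j : ZMod (m + 2)) * ((m : ZMod (m + 2)) + 1)) ↔ d ≠ 1 := by
    constructor
    · rintro ⟨j, hj, h⟩ rfl
      rw [Finset.mem_Icc] at hj
      have h' : ((1 + j : ℕ) : ZMod (m + 2)) = 0 := by
        rw [key] at h
        push_cast at h ⊢
        linear_combination h
      rw [dv] at h'
      have := Nat.le_of_dvd (by omega) h'
      omega
    · intro hd
      refine ⟨m + 2 - d, Finset.mem_Icc.2 ⟨by omega, by omega⟩, ?_⟩
      have h : ((d + (m + 2 - d) : ℕ) : ZMod (m + 2)) = 0 := by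
        rw [dv]; exact ⟨1, by omega⟩
      rw [key]
      simp only [Nat.cast_add] at h ⊢
      linear_combination h
  unfold cIJ
  rw [if_pos h2]
  by_cases hd : d = 1
  · rw [if_neg (by rw [h1]; simpa using hd), if_pos hd]; norm_num
  · rw [if_pos (by rw [h1]; exact hd), if_neg hd]; norm_num

theorem stmt11 (n k c : ℕ) (hn : Odd n) (hn3 : 3 ≤ n)
    (hk1 : 1 ≤ k) (hk2 : k ≤ n - 2) (hgcd : Nat.gcd n (k * (k + 1)) = 1)
    (hc1 : 1 ≤ c) (hc2 : c ≤ n - 1) (hc : (c * (k + 1)) % n = 1)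
    (M : Type*) [AddCommGroup M] [Module ℤ M]
    (e : ZMod n → M) (he0 : e 0 = 0)
    (heInd : LinearIndependent ℤ (fun i : {x : ZMod n // x ≠ 0} => e i.val))
    (hk : k = n - 2) :
    Δ n k c e = -T n e 1 := by
  obtain ⟨m, rfl⟩ : ∃ m, n = m + 2 := ⟨n - 2, by omega⟩
  obtain rfl : k = m := by omega
  have hcv : c = k + 1 := by
    have h1 : (k + 2) ∣ c + 1 := by
      have h2 : c * (k + 1) ≡ 1 [MOD k + 2] := by
        rw [Nat.ModEq, hc, Nat.mod_eq_of_lt (by omega)]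
      have h3 := h2.add_right c
      have h4 : c * (k + 1) + c = (k + 2) * c := by ring
      rw [h4] at h3
      have h5 := (Nat.modEq_zero_iff_dvd.2 (Dvd.intro c rfl)).symm.trans h3
      rw [add_comm c 1]
      exact Nat.modEq_zero_iff_dvd.1 h5.symm
    have := Nat.le_of_dvd (by omega) h1
    omega
  subst hcv
  have hz : ((k + 1 : ℕ) : ZMod (k + 2)) + 1 = 0 := by
    have h : ((k + 2 : ℕ) : ZMod (k + 2)) = 0 := ZMod.natCast_self _
    push_cast at h ⊢
    linear_combination h
  have hT : T (k + 2) e 1 = ∑ i ∈ Finset.Icc 1 k,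
      ι ℤ (e (i : ZMod (k + 2))) * ι ℤ (e ((i + 1 : ℕ) : ZMod (k + 2))) := by
    unfold T
    rw [Finset.sum_range_succ, hz, he0, Finset.sum_range_succ', Nat.cast_zero, he0]
    simp only [map_zero, mul_zero, zero_mul, add_zero]
    rw [← Finset.sum_image (s := Finset.range k) (g := fun i => i + 1)
      (f := fun i : ℕ => ι ℤ (e (i : ZMod (k + 2))) * ι ℤ (e ((i : ZMod (k + 2)) + 1)))
      (fun a _ b _ h => by simpa using h)]
    have : (Finset.range k).image (fun i => i + 1) = Finset.Icc 1 k := by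
      ext x
      simp only [Finset.mem_image, Finset.mem_range, Finset.mem_Icc]
      constructor
      · rintro ⟨a, h, rfl⟩; omega
      · intro h; exact ⟨x - 1, by omega, by omega⟩
    rw [this]
    simp
  have hin : ∀ I ∈ Finset.Icc 1 (k + 1), ∑ J ∈ Finset.Ioc I (k + 1),
      cIJ (k + 2) k (k + 1) I J • (ι ℤ (e (I : ZMod (k + 2))) * ι ℤ (e (J : ZMod (k + 2))))
      = if I ≤ k then
        -(ι ℤ (e (I : ZMod (k + 2))) * ι ℤ (e ((I + 1 : ℕ) : ZMod (k + 2)))) else 0 := by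
    intro I hI
    rw [Finset.mem_Icc] at hI
    have hJ : ∀ J ∈ Finset.Ioc I (k + 1),
        cIJ (k + 2) k (k + 1) I J = if J = I + 1 then -1 else 0 := by
      intro J hJ
      rw [Finset.mem_Ioc] at hJ
      obtain ⟨d, rfl⟩ : ∃ d, J = I + d := ⟨J - I, by omega⟩
      rw [cIJ_eval k I d (by omega) (by omega)]
      simp
    rw [Finset.sum_congr rfl (fun J h => by rw [hJ J h, ite_smul, zero_smul]),
      Finset.sum_ite_eq']
    by_cases h : I ≤ k
    · rw [if_pos h, if_pos (Finset.mem_Ioc.2 ⟨by omega, by omega⟩), neg_one_smul]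
    · rw [if_neg h, if_neg (by rw [Finset.mem_Ioc]; omega)]
  rw [hT]
  unfold Δ
  rw [show k + 2 - 1 = k + 1 from rfl, Finset.sum_congr rfl hin,
    Finset.sum_Icc_succ_top (by omega), if_neg (by omega), add_zero, ← Finset.sum_neg_distrib]
  exact Finset.sum_congr rfl (fun I h => if_pos (Finset.mem_Icc.1 h).2)

end Stmt
end
end

section
/- Suppose k = (n−1)/2. Then Δ_{n,(n−1)/2} = −T_{(n−1)/2} in ⋀² M. -/
open scoped Classical

noncomputable section

namespace Stmt

open ExteriorAlgebra

/-- For `n = 2m+1`, `k = m`, `c = 2`: explicit form of the coefficient. -/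
theorem cIJ_eq (m I J : ℕ) (hI : 1 ≤ I) (hIJ : I < J) (hJ : J ≤ 2 * m) :
    cIJ (2 * m + 1) m 2 I J
      = (if J = I + m + 1 then 1 else 0) - (if J = I + m then 1 else 0) := by
  have key : ∀ a : ℕ, a ≤ m + 1 →
      (((J : ZMod (2 * m + 1)) - (I : ZMod (2 * m + 1)) = (a : ZMod (2 * m + 1))) ↔ J = I + a) := by
    intro a ha
    rw [sub_eq_iff_eq_add]
    constructor
    · intro h
      have h2 : ((J - I : ℕ) : ZMod (2 * m + 1)) = ((a : ℕ) : ZMod (2 * m + 1)) := by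
        rw [Nat.cast_sub hIJ.le, h]; ring
      rw [ZMod.natCast_eq_natCast_iff'] at h2
      rw [Nat.mod_eq_of_lt (by omega), Nat.mod_eq_of_lt (by omega)] at h2
      omega
    · rintro rfl
      push_cast; ring
  have k1 := key (m + 1) le_rfl
  have k2 := key m (by omega)
  push_cast at k1
  unfold cIJ
  simp only [show 2 - 1 = 1 from rfl, Finset.Icc_self, Finset.mem_singleton, exists_eq_left,
    Nat.cast_one, one_mul, add_sub_cancel_right, k1, k2, add_assoc]

theorem inner_eq {A : Type*} [AddCommGroup A] (m I : ℕ) (hI : 1 ≤ I) (hm : 1 ≤ m)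
    (f : ℕ → A) :
    ∑ J ∈ Finset.Ioc I (2 * m), cIJ (2 * m + 1) m 2 I J • f J
      = (if I + m + 1 ≤ 2 * m then f (I + m + 1) else 0)
        - (if I + m ≤ 2 * m then f (I + m) else 0) := by
  have h1 : ∀ J ∈ Finset.Ioc I (2 * m), cIJ (2 * m + 1) m 2 I J • f J
      = (if J = I + m + 1 then f J else 0) - (if J = I + m then f J else 0) := by
    intro J hJ
    rw [Finset.mem_Ioc] at hJ
    rw [cIJ_eq m I J hI hJ.1 hJ.2, sub_smul]
    simp only [ite_smul, one_smul, zero_smul]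
  rw [Finset.sum_congr rfl h1, Finset.sum_sub_distrib, Finset.sum_ite_eq', Finset.sum_ite_eq']
  have e1 : (I + m + 1 ∈ Finset.Ioc I (2 * m)) ↔ I + m + 1 ≤ 2 * m := by
    rw [Finset.mem_Ioc]; omega
  have e2 : (I + m ∈ Finset.Ioc I (2 * m)) ↔ I + m ≤ 2 * m := by
    rw [Finset.mem_Ioc]; omega
  simp only [e1, e2]

theorem ι_anticomm {M : Type*} [AddCommGroup M] [Module ℤ M] (x y : M) :
    ι ℤ x * ι ℤ y = -(ι ℤ y * ι ℤ x) :=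
  eq_neg_of_add_eq_zero_left (ι_add_mul_swap x y)

theorem main_eq (p : ℕ) {M : Type*} [AddCommGroup M] [Module ℤ M]
    (e : ZMod (2 * (p + 1) + 1) → M) (he0 : e 0 = 0) :
    Δ (2 * (p + 1) + 1) (p + 1) 2 e
      = -T (2 * (p + 1) + 1) e ((p + 1 : ℕ) : ZMod (2 * (p + 1) + 1)) := by
  have hn0 : ((2 * (p + 1) + 1 : ℕ) : ZMod (2 * (p + 1) + 1)) = 0 := ZMod.natCast_self _
  have hΔ : Δ (2 * (p + 1) + 1) (p + 1) 2 e
      = ∑ i ∈ Finset.range p, ι ℤ (e ((i + 1 : ℕ))) * ι ℤ (e ((i + 1 + (p + 1) + 1 : ℕ)))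
        - ∑ i ∈ Finset.range (p + 1), ι ℤ (e ((i + 1 : ℕ))) * ι ℤ (e ((i + 1 + (p + 1) : ℕ))) := by
    unfold Δ
    rw [Nat.add_sub_cancel]
    rw [Finset.sum_congr rfl (fun I hI => inner_eq (p + 1) I (Finset.mem_Icc.1 hI).1 (by omega)
      (fun J => ι ℤ (e (I : ZMod (2 * (p + 1) + 1))) * ι ℤ (e (J : ZMod (2 * (p + 1) + 1)))))]
    rw [Finset.sum_sub_distrib]
    rw [← Finset.Ico_add_one_right_eq_Icc, Finset.sum_Ico_eq_sum_range, Finset.sum_Ico_eq_sum_range,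
      Nat.add_sub_cancel]
    congr 1
    · symm
      rw [← Finset.sum_subset (Finset.range_subset_range.2 (show p ≤ 2 * (p + 1) by omega))]
      · refine Finset.sum_congr rfl fun i hi => ?_
        rw [Finset.mem_range] at hi
        rw [if_pos (by omega), add_comm 1 i]
      · intro i _ hi
        rw [Finset.mem_range] at hi
        rw [if_neg (by omega)]
    · symm
      rw [← Finset.sum_subset (Finset.range_subset_range.2 (show p + 1 ≤ 2 * (p + 1) by omega))]
      · refine Finset.sum_congr rfl fun i hi => ?_
        rw [Finset.mem_range] at hi
        rw [if_pos (by omega), add_comm 1 i]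
      · intro i _ hi
        rw [Finset.mem_range] at hi
        rw [if_neg (by omega)]
  have hT : T (2 * (p + 1) + 1) e ((p + 1 : ℕ) : ZMod (2 * (p + 1) + 1))
      = ∑ i ∈ Finset.range (p + 1), ι ℤ (e ((i + 1 : ℕ))) * ι ℤ (e ((i + 1 + (p + 1) : ℕ)))
        - ∑ i ∈ Finset.range p, ι ℤ (e ((i + 1 : ℕ))) * ι ℤ (e ((i + 1 + (p + 1) + 1 : ℕ))) := by
    unfold T
    rw [Finset.sum_range_succ']
    have hr : Finset.range (2 * (p + 1)) = Finset.range ((p + 1) + (p + 1)) := by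
      congr 1; ring
    rw [hr, Finset.sum_range_add, Finset.sum_range_succ' _ p, Finset.sum_range_succ' _ p,
      Finset.sum_range_succ' _ p, sub_eq_add_neg, ← Finset.sum_neg_distrib]
    have z1 : e ((0 : ℕ) : ZMod (2 * (p + 1) + 1)) = 0 := by simpa using he0
    have z2 : e (((p + 1 + 0 + 1 : ℕ) : ZMod (2 * (p + 1) + 1)) + ((p + 1 : ℕ))) = 0 := by
      rw [← Nat.cast_add, show p + 1 + 0 + 1 + (p + 1) = 2 * (p + 1) + 1 by ring, hn0, he0]
    have z3 : ∀ i : ℕ, ((p + 1 + (i + 1) + 1 : ℕ) : ZMod (2 * (p + 1) + 1)) + ((p + 1 : ℕ))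
        = ((i + 1 : ℕ) : ZMod (2 * (p + 1) + 1)) := by
      intro i
      rw [← Nat.cast_add, show p + 1 + (i + 1) + 1 + (p + 1) = (2 * (p + 1) + 1) + (i + 1) by ring,
        Nat.cast_add, hn0, zero_add]
    have z4 : ∀ i : ℕ, p + 1 + (i + 1) + 1 = i + 1 + (p + 1) + 1 := by intro i; ring
    have z5 : ∀ i : ℕ, ι ℤ (e ((p + 1 + (i + 1) + 1 : ℕ) : ZMod (2 * (p + 1) + 1)))
          * ι ℤ (e (((p + 1 + (i + 1) + 1 : ℕ) : ZMod (2 * (p + 1) + 1)) + ((p + 1 : ℕ))))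
        = -(ι ℤ (e ((i + 1 : ℕ))) * ι ℤ (e ((i + 1 + (p + 1) + 1 : ℕ)))) := by
      intro i
      rw [z3, z4, ι_anticomm]
    rw [Finset.sum_congr rfl (fun i _ => z5 i), z1, z2]
    simp only [map_zero, mul_zero, zero_mul, add_zero, Nat.cast_add]
  rw [hΔ, hT, neg_sub]

theorem stmt13 (n k c : ℕ) (hn : Odd n) (hn3 : 3 ≤ n)
    (hk1 : 1 ≤ k) (hk2 : k ≤ n - 2) (hgcd : Nat.gcd n (k * (k + 1)) = 1)
    (hc1 : 1 ≤ c) (hc2 : c ≤ n - 1) (hc : (c * (k + 1)) % n = 1)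
    (M : Type*) [AddCommGroup M] [Module ℤ M]
    (e : ZMod n → M) (he0 : e 0 = 0)
    (heInd : LinearIndependent ℤ (fun i : {x : ZMod n // x ≠ 0} => e i.val))
    (hk : k = (n - 1) / 2) :
    Δ n k c e = -T n e (((n - 1) / 2 : ℕ) : ZMod n) := by
  obtain ⟨m, rfl⟩ := hn
  have hkm : k = m := by omega
  subst hkm
  have hc2' : c = 2 := by
    have h1 : (c * (k + 1)) ≡ 1 [MOD (2 * k + 1)] := by
      unfold Nat.ModEq
      rw [hc, Nat.mod_eq_of_lt (by omega)]
    have h2 : 2 * (c * (k + 1)) ≡ 2 * 1 [MOD (2 * k + 1)] := h1.mul_left 2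
    have h3 : 2 * (c * (k + 1)) ≡ c [MOD (2 * k + 1)] := by
      unfold Nat.ModEq
      rw [show 2 * (c * (k + 1)) = c + (2 * k + 1) * c by ring, Nat.add_mul_mod_self_left]
    have h4 := h3.symm.trans h2
    unfold Nat.ModEq at h4
    rwa [Nat.mod_eq_of_lt (by omega), Nat.mod_eq_of_lt (by omega)] at h4
  subst hc2'
  rw [← hk]
  obtain ⟨p, rfl⟩ : ∃ p, k = p + 1 := ⟨k - 1, by omega⟩
  exact main_eq p e he0

end Stmt
end
end

section
/- Suppose k = (n−3)/2 (so n ≥ 5 and gcd(n, 3) = 1). Then Δ_{n,(n−3)/2} = T_{(n−1)/2} − T_1 in ⋀² M. -/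
open scoped Classical

noncomputable section

namespace Stmt

open ExteriorAlgebra

theorem T_expand (n : ℕ) (hn3 : 3 ≤ n) {M : Type*} [AddCommGroup M] [Module ℤ M] (e : ZMod n → M)
    (he0 : e 0 = 0) (r : ZMod n) :
    T n e r = ∑ I ∈ Finset.Icc 1 (n - 1), ∑ J ∈ Finset.Ioc I (n - 1),
      ((if ((J : ZMod n) - (I : ZMod n)) = r then 1 else 0)
        - (if ((J : ZMod n) - (I : ZMod n)) = -r then 1 else 0) : ℤ) •
          (ι ℤ (e (I : ZMod n)) * ι ℤ (e (J : ZMod n))) := by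
  have : NeZero n := ⟨by omega⟩
  have hanti : ∀ x y : M, ι ℤ x * ι ℤ y = - (ι ℤ y * ι ℤ x) := by
    intro x y
    exact eq_neg_of_add_eq_zero_left (ι_add_mul_swap x y)
  have hr : Finset.range n = insert 0 (Finset.Icc 1 (n - 1)) := by
    ext x; simp only [Finset.mem_range, Finset.mem_insert, Finset.mem_Icc]; omega
  have h1 : T n e r = ∑ I ∈ Finset.Icc 1 (n - 1), ∑ J ∈ Finset.Icc 1 (n - 1),
      (if ((J : ZMod n) - (I : ZMod n)) = r then
        ι ℤ (e (I : ZMod n)) * ι ℤ (e (J : ZMod n)) else 0) := by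
    have h2 : T n e r = ∑ I ∈ Finset.range n, ∑ J ∈ Finset.range n,
      (if ((J : ZMod n) - (I : ZMod n)) = r then
        ι ℤ (e (I : ZMod n)) * ι ℤ (e (J : ZMod n)) else 0) := by
      unfold T
      refine Finset.sum_congr rfl fun i _ => ?_
      rw [Finset.sum_eq_single (((i : ZMod n) + r).val)]
      · simp
      · intro b hb hne
        rw [if_neg]
        intro h
        apply hne
        rw [← h]
        simp [ZMod.val_natCast, Nat.mod_eq_of_lt (Finset.mem_range.1 hb)]
      · intro h
        exact absurd (Finset.mem_range.2 (ZMod.val_lt _)) h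
    rw [h2, hr, Finset.sum_insert (by simp)]
    simp only [Finset.sum_insert (show (0 : ℕ) ∉ Finset.Icc 1 (n - 1) by simp)]
    simp [he0]
  have h3 : ∀ I ∈ Finset.Icc 1 (n - 1), Finset.Ioc I (n - 1) =
      (Finset.Icc 1 (n - 1)).filter (fun J => I < J) := by
    intro I hI
    ext x
    simp only [Finset.mem_Icc, Finset.mem_Ioc, Finset.mem_filter] at *
    omega
  rw [h1]
  refine Eq.trans ?_ (Finset.sum_congr rfl (fun I hI => by
    rw [h3 I hI, Finset.sum_filter])).symm
  have h4 : ∀ I J : ℕ, (if ((J : ZMod n) - (I : ZMod n)) = r then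
        ι ℤ (e (I : ZMod n)) * ι ℤ (e (J : ZMod n)) else 0)
      = (if I < J then (if ((J : ZMod n) - (I : ZMod n)) = r then
        ι ℤ (e (I : ZMod n)) * ι ℤ (e (J : ZMod n)) else 0) else 0)
      + (if J < I then (if ((J : ZMod n) - (I : ZMod n)) = r then
        ι ℤ (e (I : ZMod n)) * ι ℤ (e (J : ZMod n)) else 0) else 0) := by
    intro I J
    rcases lt_trichotomy I J with h | h | h
    · simp [h, h.not_gt]
    · subst h; simp
    · simp [h, h.not_gt]
  refine (Finset.sum_congr rfl fun I _ => Finset.sum_congr rfl fun J _ => h4 I J).trans ?_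
  simp_rw [Finset.sum_add_distrib]
  rw [Finset.sum_comm (f := fun I J : ℕ => (if J < I then
    (if ((J : ZMod n) - (I : ZMod n)) = r then
        ι ℤ (e (I : ZMod n)) * ι ℤ (e (J : ZMod n)) else 0) else 0))]
  simp_rw [← Finset.sum_add_distrib]
  refine Finset.sum_congr rfl fun I _ => Finset.sum_congr rfl fun J _ => ?_
  by_cases h : I < J
  · simp only [h, if_true]
    have hiff : ((I : ZMod n) - (J : ZMod n)) = r ↔ ((J : ZMod n) - (I : ZMod n)) = -r := by
      rw [← neg_sub, neg_eq_iff_eq_neg]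
    rw [hanti (e J) (e I)]
    simp only [hiff]
    split_ifs <;> simp
  · simp [h]

theorem exists_iff (n : ℕ) (hn5 : 5 ≤ n) (x : ZMod n) :
    (∃ j ∈ Finset.Icc 1 (n - 3), x = (j : ZMod n)) ↔ (x ≠ 0 ∧ x ≠ -1 ∧ x ≠ -2) := by
  have : NeZero n := ⟨by omega⟩
  have e1 : (-1 : ZMod n) = ((n - 1 : ℕ) : ZMod n) := by
    rw [Nat.cast_sub (by omega)]; simp
  have e2 : (-2 : ZMod n) = ((n - 2 : ℕ) : ZMod n) := by
    rw [Nat.cast_sub (by omega)]; simp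
  have e0 : (0 : ZMod n) = ((0 : ℕ) : ZMod n) := by simp
  have key : ∀ a b : ℕ, a < n → b < n → ((a : ZMod n) = b ↔ a = b) := by
    intro a b ha hb
    rw [ZMod.natCast_eq_natCast_iff', Nat.mod_eq_of_lt ha, Nat.mod_eq_of_lt hb]
  have hx : x = ((x.val : ℕ) : ZMod n) := by simp
  have hlt := ZMod.val_lt x
  generalize x.val = a at hx hlt
  subst hx
  rw [e1, e2, e0]
  simp only [Ne]
  rw [key a 0 hlt (by omega), key a _ hlt (by omega), key a _ hlt (by omega)]
  constructor
  · rintro ⟨j, hj, h⟩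
    rw [Finset.mem_Icc] at hj
    rw [key a j hlt (by omega)] at h
    omega
  · intro h
    exact ⟨a, Finset.mem_Icc.2 (by omega), rfl⟩

theorem exists_iff' (n : ℕ) (hn5 : 5 ≤ n) (K d : ZMod n) (hK : 2 * K = -1) :
    (∃ j ∈ Finset.Icc 1 (n - 3), d = (j : ZMod n) * K) ↔ (d ≠ 0 ∧ d ≠ -K ∧ d ≠ 1) := by
  have h : ∀ j : ZMod n, d = j * K ↔ -2 * d = j := by
    intro j
    constructor
    · rintro rfl; linear_combination (-j) * hK
    · rintro rfl; linear_combination d * hK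
  simp only [h]
  rw [exists_iff n hn5]
  have c : ∀ y : ZMod n, -2 * d = y ↔ d = y * K := fun y => (h y).symm
  simp only [Ne, c]
  rw [zero_mul, neg_one_mul, show (-2 : ZMod n) * K = 1 by linear_combination -hK]

theorem stmt14 (n k c : ℕ) (hn : Odd n) (hn3 : 3 ≤ n)
    (hk1 : 1 ≤ k) (hk2 : k ≤ n - 2) (hgcd : Nat.gcd n (k * (k + 1)) = 1)
    (hc1 : 1 ≤ c) (hc2 : c ≤ n - 1) (hc : (c * (k + 1)) % n = 1)
    (M : Type*) [AddCommGroup M] [Module ℤ M]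
    (e : ZMod n → M) (he0 : e 0 = 0)
    (heInd : LinearIndependent ℤ (fun i : {x : ZMod n // x ≠ 0} => e i.val))
    (hk : k = (n - 3) / 2) :
    Δ n k c e = T n e (((n - 1) / 2 : ℕ) : ZMod n) - T n e 1 := by
  obtain ⟨m, rfl⟩ := hn
  have hkm : k = m - 1 := by omega
  have hn5 : 5 ≤ 2 * m + 1 := by omega
  have : NeZero (2 * m + 1) := ⟨by omega⟩
  have hm : ((2 * m + 1 : ℕ) : ZMod (2 * m + 1)) = 0 := ZMod.natCast_self _
  have hk' : (k : ZMod (2 * m + 1)) + 1 = (m : ZMod (2 * m + 1)) := by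
    rw [← Nat.cast_succ]; congr 1; omega
  have hK : 2 * (m : ZMod (2 * m + 1)) = -1 := by
    push_cast at hm
    linear_combination hm
  have key : ∀ a b : ℕ, a < 2 * m + 1 → b < 2 * m + 1 →
      ((a : ZMod (2 * m + 1)) = b ↔ a = b) := by
    intro a b ha hb
    rw [ZMod.natCast_eq_natCast_iff', Nat.mod_eq_of_lt ha, Nat.mod_eq_of_lt hb]
  have hcc : c = 2 * m + 1 - 2 := by
    rw [← key c _ (by omega) (by omega), Nat.cast_sub (by omega), hm]
    have h1 : ((c * (k + 1) : ℕ) : ZMod (2 * m + 1)) = ((1 : ℕ) : ZMod (2 * m + 1)) := by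
      rw [ZMod.natCast_eq_natCast_iff', hc, Nat.mod_eq_of_lt (by omega)]
    push_cast at h1 ⊢
    rw [hk'] at h1
    linear_combination (-2) * h1 + (c : ZMod (2 * m + 1)) * hK
  have hc3 : c - 1 = 2 * m + 1 - 3 := by omega
  have hhalf : (2 * m + 1 - 1) / 2 = m := by omega
  rw [T_expand _ hn3 e he0, T_expand _ hn3 e he0, ← Finset.sum_sub_distrib, hhalf]
  unfold Δ
  refine Finset.sum_congr rfl fun I hI => ?_
  rw [← Finset.sum_sub_distrib]
  refine Finset.sum_congr rfl fun J hJ => ?_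
  rw [← sub_smul]
  congr 1
  unfold cIJ
  simp only [hc3, hk', eq_sub_iff_add_eq, exists_iff' _ hn5 _ _ hK]
  rw [Finset.mem_Icc] at hI
  rw [Finset.mem_Ioc] at hJ
  have hd0 : (J : ZMod (2 * m + 1)) - I ≠ 0 := by
    rw [sub_ne_zero, Ne, key _ _ (by omega) (by omega)]; omega
  have hm1 : (m : ZMod (2 * m + 1)) ≠ -1 := by
    intro h
    have : ((m + 1 : ℕ) : ZMod (2 * m + 1)) = (0 : ℕ) := by push_cast; rw [h]; ring
    rw [key _ _ (by omega) (by omega)] at this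
    omega
  generalize (J : ZMod (2 * m + 1)) - I = d at *
  have a1 : d + 1 = 0 ↔ d = -1 := by rw [add_eq_zero_iff_eq_neg]
  have a2 : d + 1 = -(m : ZMod (2 * m + 1)) ↔ d = m := by
    constructor
    · intro h; linear_combination h - hK
    · intro h; linear_combination h + hK
  have a3 : d + 1 = 1 ↔ d = 0 := by simp
  have b1 : (1 : ZMod (2 * m + 1)) ≠ -m := fun h => hm1 (by linear_combination h)
  have b2 : (1 : ZMod (2 * m + 1)) ≠ -1 := by
    intro h
    have : ((2 : ℕ) : ZMod (2 * m + 1)) = (0 : ℕ) := by push_cast; linear_combination h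
    rw [key _ _ (by omega) (by omega)] at this
    omega
  simp only [Ne, a1, a2, a3, hd0, not_false_eq_true, true_and, and_true]
  by_cases p1 : d = 1 <;> by_cases p2 : d = -1 <;> by_cases p3 : d = m <;>
    by_cases p4 : d = -m <;> simp only [p1, p2, p3, p4, not_true_eq_false, not_false_eq_true,
      and_self, and_true, and_false, true_and, false_and, if_true, if_false] <;> grind

end Stmt
end
end

section
/- Let S_{n,k} ⊆ ℤ/nℤ be the set of residues r with r ≡ j(k+1) (mod n) for some integer j with 1 ≤ j ≤ c−1 (note 0 ∉ S_{n,k}). Then Σ_{r ∈ S_{n,k}} (−T_{r−1} + T_r) = 2·Δ_{n,k} in ⋀² M, where T is regarded as a function on ℤ/nℤ (it satisfies T_{n−r} = −T_r). -/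
open scoped Classical

noncomputable section

namespace Stmt

open ExteriorAlgebra

lemma sum_range_zmod {A : Type*} [AddCommMonoid A] (n : ℕ) [NeZero n] (g : ZMod n → A) :
    ∑ r ∈ Finset.range n, g (r : ZMod n) = ∑ x : ZMod n, g x := by
  refine Finset.sum_bij' (fun r _ => (r : ZMod n)) (fun x _ => x.val) ?_ ?_ ?_ ?_ ?_
  · intros; simp
  · intro x _; simpa using ZMod.val_lt x
  · intro r hr; exact ZMod.val_cast_of_lt (Finset.mem_range.mp hr)
  · intro x _; simp
  · intros; rfl

lemma sum_symm {A : Type*} [AddCommGroup A] (n : ℕ) (G : ℕ → ℕ → A)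
    (hs : ∀ i j, G i j = G j i) (hd : ∀ i, G i i = 0) (h0 : ∀ j, G 0 j = 0) :
    ∑ i ∈ Finset.range n, ∑ j ∈ Finset.range n, G i j =
      (2 : ℤ) • ∑ I ∈ Finset.Icc 1 (n - 1), ∑ J ∈ Finset.Ioc I (n - 1), G I J := by
  have h1 : ∀ i j, G i j = (if i < j then G i j else 0) + (if j < i then G j i else 0) := by
    intro i j
    rcases lt_trichotomy i j with h | h | h
    · simp [h, h.not_gt]
    · subst h; simp [hd]
    · simp [h, h.not_gt, hs i j]
  have h2 : ∑ i ∈ Finset.range n, ∑ j ∈ Finset.range n, (if i < j then G i j else 0) =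
      ∑ I ∈ Finset.Icc 1 (n - 1), ∑ J ∈ Finset.Ioc I (n - 1), G I J := by
    symm
    have h3 : ∀ I, ∑ J ∈ Finset.Ioc I (n - 1), G I J =
        ∑ j ∈ Finset.range n, (if I < j then G I j else 0) := by
      intro I
      rw [← Finset.sum_filter]
      apply Finset.sum_congr _ (fun _ _ => rfl)
      ext x; simp; omega
    simp only [h3]
    apply Finset.sum_subset
    · intro x; simp; omega
    · intro x hx hx'
      have : x = 0 := by simp at hx hx'; omega
      subst this
      simp [h0]
  have h4 : ∑ i ∈ Finset.range n, ∑ j ∈ Finset.range n, G i j =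
    ∑ i ∈ Finset.range n, ∑ j ∈ Finset.range n,
      ((if i < j then G i j else 0) + (if j < i then G j i else 0)) :=
    Finset.sum_congr rfl fun i _ => Finset.sum_congr rfl fun j _ => h1 i j
  rw [h4]
  simp only [Finset.sum_add_distrib]
  rw [Finset.sum_comm (f := fun i j => if j < i then G j i else 0), h2, two_zsmul]

theorem stmt17 (n k c : ℕ) (hn : Odd n) (hn3 : 3 ≤ n)
    (hk1 : 1 ≤ k) (hk2 : k ≤ n - 2) (hgcd : Nat.gcd n (k * (k + 1)) = 1)
    (hc1 : 1 ≤ c) (hc2 : c ≤ n - 1) (hc : (c * (k + 1)) % n = 1)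
    (M : Type*) [AddCommGroup M] [Module ℤ M]
    (e : ZMod n → M) (he0 : e 0 = 0)
    (heInd : LinearIndependent ℤ (fun i : {x : ZMod n // x ≠ 0} => e i.val))
    :
    ∑ r ∈ (Finset.range n).filter (fun r => ∃ j ∈ Finset.Icc 1 (c - 1), (r : ZMod n) = (j : ZMod n) * ((k : ZMod n) + 1)), (-(T n e ((r : ZMod n) - 1)) + T n e (r : ZMod n)) = (2 : ℤ) • Δ n k c e := by
  have : NeZero n := ⟨by omega⟩
  have hcz : (c : ZMod n) * ((k : ZMod n) + 1) = 1 := by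
    have h : ((c * (k + 1) : ℕ) : ZMod n) = ((1 : ℕ) : ZMod n) := by
      rw [ZMod.natCast_eq_natCast_iff, Nat.ModEq, hc, Nat.mod_eq_of_lt (by omega)]
    push_cast at h
    exact h
  obtain ⟨P, hP⟩ : ∃ P : ZMod n → Prop, ∀ x, P x ↔ ∃ j ∈ Finset.Icc 1 (c - 1),
      x = (j : ZMod n) * ((k : ZMod n) + 1) := ⟨_, fun _ => Iff.rfl⟩
  have hP1 : ∀ x, P x → P (1 - x) := by
    intro x hx
    obtain ⟨j, hj, rfl⟩ := (hP x).1 hx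
    rw [Finset.mem_Icc] at hj
    refine (hP _).2 ⟨c - j, by rw [Finset.mem_Icc]; omega, ?_⟩
    rw [Nat.cast_sub (by omega), sub_mul, hcz]
  have hP2 : ∀ x, P (1 - x) ↔ P x := fun x => ⟨fun h => by simpa using hP1 _ h, hP1 x⟩
  let χ : ZMod n → ℤ := fun x => if P x then 1 else 0
  let f : ZMod n → ℤ := fun d => χ d - χ (d + 1)
  have hχ : ∀ x, χ (1 - x) = χ x := fun x => by simp only [χ, hP2]
  have hf : ∀ d, f (-d) = - f d := by
    intro d
    have h1 := hχ d
    have h2 := hχ (-d)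
    simp only [f]
    rw [← h2, show -d + 1 = 1 - d by ring, h1, show 1 - -d = d + 1 by ring]
    ring
  have hcIJ : ∀ I J : ℕ, cIJ n k c I J = f ((J : ZMod n) - I) := by
    intro I J
    have hq : ∀ j : ℕ, ((J : ZMod n) - I = (j : ZMod n) * ((k : ZMod n) + 1) - 1) ↔
        ((J : ZMod n) - I + 1 = (j : ZMod n) * ((k : ZMod n) + 1)) :=
      fun j => eq_sub_iff_add_eq
    simp only [cIJ, f, χ, hP, hq]
    congr
  let w : ZMod n → ZMod n → ExteriorAlgebra ℤ M := fun i j => ι ℤ (e i) * ι ℤ (e j)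
  have hw : ∀ i j, w i j = - w j i := by
    intro i j
    exact eq_neg_of_add_eq_zero_left (ExteriorAlgebra.ι_add_mul_swap _ _)
  have hT : ∀ r, T n e r = ∑ i : ZMod n, w i (i + r) := by
    intro r
    rw [← sum_range_zmod]; rfl
  have hΔ : Δ n k c e = ∑ I ∈ Finset.Icc 1 (n - 1), ∑ J ∈ Finset.Ioc I (n - 1),
      f ((J : ZMod n) - I) • w I J := by
    simp only [Δ, hcIJ, w]
  rw [hΔ, ← sum_symm n (fun I J => f ((J : ZMod n) - I) • w I J)]
  · simp only [← hP]
    rw [Finset.sum_filter]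
    have hU : (do let a ← Finset.range n; pure (a : ZMod n) : Finset (ZMod n)) = Finset.univ := by
      ext x
      simp only [Finset.bind_def, Finset.pure_def, Finset.mem_sup, Finset.mem_singleton,
        Finset.mem_range, Finset.mem_univ, iff_true]
      exact ⟨x.val, ZMod.val_lt x, by simp⟩
    rw [hU]
    have e1 : ∀ x, (if P x then -(T n e (x - 1)) + T n e x else 0) =
        χ x • T n e x - χ x • T n e (x - 1) := by
      intro x
      by_cases h : P x
      · simp only [χ, h, if_true, one_smul]; abel
      · simp only [χ, h, if_false, zero_smul, sub_zero]
    have e2 : ∑ x : ZMod n, χ x • T n e (x - 1) = ∑ x : ZMod n, χ (x + 1) • T n e x := by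
      rw [← Equiv.sum_comp (Equiv.addRight (1 : ZMod n))]
      simp
    rw [Finset.sum_congr rfl (fun x _ => e1 x), Finset.sum_sub_distrib, e2,
      ← Finset.sum_sub_distrib]
    simp only [← sub_smul]
    have e3 : ∀ I : ℕ, ∑ J ∈ Finset.range n, f ((J : ZMod n) - I) • w I J =
        ∑ y : ZMod n, f (y - I) • w I y := fun I =>
      sum_range_zmod n (fun y => f (y - I) • w I y)
    simp only [e3]
    rw [sum_range_zmod n (fun x => ∑ y : ZMod n, f (y - x) • w x y)]
    simp only [hT, Finset.smul_sum]
    rw [Finset.sum_comm]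
    refine Finset.sum_congr rfl fun i _ => ?_
    rw [← Equiv.sum_comp (Equiv.addLeft i) (fun y => f (y - i) • w i y)]
    simp [f]
  · intro i j
    rw [hw, ← neg_sub (i : ZMod n) j, hf, smul_neg, neg_smul, neg_neg]
  · intro i
    have : w i i = 0 := ExteriorAlgebra.ι_sq_zero _
    simp only [this, smul_zero]
  · intro j
    simp [w, he0]

end Stmt
end
end
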